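/- Extension Lemma: Assume L is countable. Let Γ be a set of L⁺-sentences such that infinitely many of the constants a_i do not occur in Γ. If Γ ⊬ φ, then there exists Γ* ⊇ Γ such that Γ* is a prime saturated BQL_CD^r-theory and φ ∉ Γ*. -/

import Mathlib

universe u v

namespace BQL

structure Signature : Type 1 where
  Const : Type
  Func : Type
  arityF : Func → ℕ
  Rel : Type
  arityR : Rel → ℕ

inductive Term (L : Signature) : Type
  | var : ℕ → Term L
  | const : L.Const → Term L
  | func : (f : L.Func) → (Fin (L.arityF f) → Term L) → Term L

inductive Formula (L : Signature) : Type
  | top : Formula L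
  | bot : Formula L
  | rel : (R : L.Rel) → (Fin (L.arityR R) → Term L) → Formula L
  | and : Formula L → Formula L → Formula L
  | or : Formula L → Formula L → Formula L
  | imp : Formula L → Formula L → Formula L
  | all : Formula L → Formula L
  | ex : Formula L → Formula L

variable {L : Signature}

namespace Term

/-- Shift all (free) variables of a term up by one. -/
def shiftUp : Term L → Term L
  | var n => var (n + 1)
  | const c => const c
  | func f ts => func f fun i => (ts i).shiftUp

/-- Apply a simultaneous substitution to a term. -/
def applySub (σ : ℕ → Term L) : Term L → Term L
  | var n => σ n
  | const c => const c
  | func f ts => func f fun i => (ts i).applySub σ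

/-- All variables of the term are `< k`. -/
def ClosedAt : Term L → ℕ → Prop
  | var n, k => n < k
  | const _, _ => True
  | func _ ts, k => ∀ i, (ts i).ClosedAt k

/-- A closed term. -/
def Closed (t : Term L) : Prop := t.ClosedAt 0

/-- The constant `c` occurs in the term. -/
def OccC (c : L.Const) : Term L → Prop
  | var _ => False
  | const d => d = c
  | func _ ts => ∃ i, (ts i).OccC c

end Term

/-- Lift a substitution under a binder. -/
def liftSub (σ : ℕ → Term L) : ℕ → Term L
  | 0 => .var 0
  | n + 1 => (σ n).shiftUp

namespace Formula

/-- Apply a simultaneous substitution to a formula. -/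
def applySub (σ : ℕ → Term L) : Formula L → Formula L
  | top => top
  | bot => bot
  | rel R ts => rel R fun i => (ts i).applySub σ
  | and φ ψ => and (φ.applySub σ) (ψ.applySub σ)
  | or φ ψ => or (φ.applySub σ) (ψ.applySub σ)
  | imp φ ψ => imp (φ.applySub σ) (ψ.applySub σ)
  | all φ => all (φ.applySub (liftSub σ))
  | ex φ => ex (φ.applySub (liftSub σ))

/-- All free variables of the formula are `< k`. -/
def ClosedAt : Formula L → ℕ → Prop
  | top, _ => True
  | bot, _ => True
  | rel _ ts, k => ∀ i, (ts i).ClosedAt k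
  | and φ ψ, k => φ.ClosedAt k ∧ ψ.ClosedAt k
  | or φ ψ, k => φ.ClosedAt k ∧ ψ.ClosedAt k
  | imp φ ψ, k => φ.ClosedAt k ∧ ψ.ClosedAt k
  | all φ, k => φ.ClosedAt (k + 1)
  | ex φ, k => φ.ClosedAt (k + 1)

/-- A sentence: a formula with no free variables. -/
def Sentence (φ : Formula L) : Prop := φ.ClosedAt 0

/-- The constant `c` occurs in the formula. -/
def OccC (c : L.Const) : Formula L → Prop
  | top => False
  | bot => False
  | rel _ ts => ∃ i, (ts i).OccC c
  | and φ ψ => φ.OccC c ∨ ψ.OccC c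
  | or φ ψ => φ.OccC c ∨ ψ.OccC c
  | imp φ ψ => φ.OccC c ∨ ψ.OccC c
  | all φ => φ.OccC c
  | ex φ => φ.OccC c

/-- The formula contains no occurrence of `∨` and no occurrence of `∃`. -/
def NoOrEx : Formula L → Prop
  | top => True
  | bot => True
  | rel _ _ => True
  | and φ ψ => φ.NoOrEx ∧ ψ.NoOrEx
  | or _ _ => False
  | imp φ ψ => φ.NoOrEx ∧ ψ.NoOrEx
  | all φ => φ.NoOrEx
  | ex _ => False

end Formula

/-- Substitute the term `t` for the variable `v₀` (lowering the other variables). -/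
def subst0 (φ : Formula L) (t : Term L) : Formula L :=
  φ.applySub fun n => match n with | 0 => t | n + 1 => .var n

/-- `□ⁿφ`, where `□φ` abbreviates `⊤ → φ`. -/
def boxN : ℕ → Formula L → Formula L
  | 0, φ => φ
  | n + 1, φ => .imp .top (boxN n φ)

/-- The conjunction of a finite list of formulas (`⋀∅ = ⊤`). -/
def conjL : List (Formula L) → Formula L
  | [] => .top
  | [φ] => φ
  | φ :: ψ :: l => .and φ (conjL (ψ :: l))

/-- The language `L⁺`, obtained from `L` by adding countably many fresh constants `aᵢ`. -/
def Signature.plus (L : Signature) : Signature where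
  Const := L.Const ⊕ ℕ
  Func := L.Func
  arityF := L.arityF
  Rel := L.Rel
  arityR := L.arityR

/-- The fresh constant `aᵢ` of `L⁺`. -/
def aconst (L : Signature) (i : ℕ) : Term L.plus := .const (Sum.inr i)

/-- Embedding of `L`-terms into `L⁺`-terms. -/
def Term.emb : Term L → Term L.plus
  | .var n => .var n
  | .const c => .const (Sum.inl c)
  | .func f ts => .func f fun i => (ts i).emb

/-- Embedding of `L`-formulas into `L⁺`-formulas. -/
def Formula.emb : Formula L → Formula L.plus
  | .top => .top
  | .bot => .bot
  | .rel R ts => .rel R fun i => (ts i).emb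
  | .and φ ψ => .and φ.emb ψ.emb
  | .or φ ψ => .or φ.emb ψ.emb
  | .imp φ ψ => .imp φ.emb ψ.emb
  | .all φ => .all φ.emb
  | .ex φ => .ex φ.emb

/-- The fresh constant `aᵢ` occurs in no member of `Γ`. -/
def FreshIn (i : ℕ) (Γ : Set (Formula L.plus)) : Prop :=
  ∀ ψ ∈ Γ, ¬ ψ.OccC (Sum.inr i)

/-- A Kripke `L`-model (the frame conditions are packaged in `KModel.Proper`). -/
structure KModel (L : Signature) : Type (u + 1) where
  W : Type u
  acc : W → W → Prop
  D : Type u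
  interpC : L.Const → D
  interpF : (f : L.Func) → (Fin (L.arityF f) → D) → D
  interpR : (R : L.Rel) → W → Set (Fin (L.arityR R) → D)

/-- The conditions on an `L`-model: nonempty set of worlds, transitive accessibility
relation, nonempty domain, and the persistence constraint. -/
def KModel.Proper (M : KModel.{u} L) : Prop :=
  Nonempty M.W ∧ Nonempty M.D ∧ Transitive M.acc ∧
    ∀ (R : L.Rel) (w u' : M.W), M.acc w u' → M.interpR R w ⊆ M.interpR R u'

/-- Prepend a value to a valuation. -/
def vcons {α : Sort*} (d : α) (ρ : ℕ → α) : ℕ → α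
  | 0 => d
  | n + 1 => ρ n

/-- Denotation of a term. -/
def Term.eval (M : KModel.{u} L) (ρ : ℕ → M.D) : Term L → M.D
  | .var n => ρ n
  | .const c => M.interpC c
  | .func f ts => M.interpF f fun i => (ts i).eval M ρ

/-- The satisfaction relation `w ⊩ φ(ā)`. -/
def Sat (M : KModel.{u} L) : M.W → (ℕ → M.D) → Formula L → Prop
  | _, _, .top => True
  | _, _, .bot => False
  | w, ρ, .rel R ts => (fun i => (ts i).eval M ρ) ∈ M.interpR R w
  | w, ρ, .and φ ψ => Sat M w ρ φ ∧ Sat M w ρ ψ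
  | w, ρ, .or φ ψ => Sat M w ρ φ ∨ Sat M w ρ ψ
  | w, ρ, .imp φ ψ => ∀ u', M.acc w u' → Sat M u' ρ φ → Sat M u' ρ ψ
  | w, ρ, .all φ => ∀ d, Sat M w (vcons d ρ) φ
  | w, ρ, .ex φ => ∃ d, Sat M w (vcons d ρ) φ

/-- Satisfaction of a sentence (under every valuation). -/
def SatS (M : KModel.{u} L) (w : M.W) (φ : Formula L) : Prop := ∀ ρ, Sat M w ρ φ

/-- `Γ ⊨ φ`: truth is preserved at every reflexive world of every `L`-model. -/
def Models (Γ : Set (Formula L)) (φ : Formula L) : Prop :=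
  ∀ M : KModel.{u} L, M.Proper → ∀ w : M.W, M.acc w w →
    (∀ ψ ∈ Γ, SatS M w ψ) → SatS M w φ

/-- `Γ : Δ ⊨ φ`: for every `L`-model, every reflexive world `w` and every world `u ≻ w`:
if `w ⊩ Γ` and `u ⊩ Δ` then `u ⊩ φ`. -/
def ModelsCtx (Γ Δ : Set (Formula L)) (φ : Formula L) : Prop :=
  ∀ M : KModel.{u} L, M.Proper → ∀ w u' : M.W, M.acc w w → M.acc w u' →
    (∀ ψ ∈ Γ, SatS M w ψ) → (∀ ψ ∈ Δ, SatS M u' ψ) → SatS M u' φ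

end BQL

namespace BQL

/-- `Prf L Γ Δ φ` formalizes `Γ : Δ ⊢ φ`: there is a proof of `φ` in the natural
deduction system `NBQL_CD^r` (over `L⁺`-sentences) whose open assumptions all belong
to `Γ ∪ Δ` and in which every open assumption occurring *unsafely* (i.e. in the right
main subproof of an application of `→`-Elim) belongs to `Γ`.  Assumptions may be
discharged only at safe occurrences, so discharge always happens in the `Δ` zone. -/
inductive Prf (L : Signature) :
    Set (Formula L.plus) → Set (Formula L.plus) → Formula L.plus → Prop
  | hyp {Γ Δ : Set (Formula L.plus)} {φ} : φ ∈ Γ ∪ Δ → φ.Sentence → Prf L Γ Δ φ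
  | weaken {Γ Γ' Δ Δ' φ} : Γ ⊆ Γ' → Δ ⊆ Δ' → Prf L Γ Δ φ → Prf L Γ' Δ' φ
  | topIntro {Γ Δ} : Prf L Γ Δ .top
  | botElim {Γ Δ φ} : φ.Sentence → Prf L Γ Δ .bot → Prf L Γ Δ φ
  | andIntro {Γ Δ φ ψ} : Prf L Γ Δ φ → Prf L Γ Δ ψ → Prf L Γ Δ (.and φ ψ)
  | andElimL {Γ Δ φ ψ} : Prf L Γ Δ (.and φ ψ) → Prf L Γ Δ φ
  | andElimR {Γ Δ φ ψ} : Prf L Γ Δ (.and φ ψ) → Prf L Γ Δ ψ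
  | orIntroL {Γ Δ φ ψ} : ψ.Sentence → Prf L Γ Δ φ → Prf L Γ Δ (.or φ ψ)
  | orIntroR {Γ Δ φ ψ} : φ.Sentence → Prf L Γ Δ ψ → Prf L Γ Δ (.or φ ψ)
  | orElim {Γ Δ φ ψ χ} : Prf L Γ Δ (.or φ ψ) → Prf L Γ (insert φ Δ) χ →
      Prf L Γ (insert ψ Δ) χ → Prf L Γ Δ χ
  | impIntro {Γ Δ φ ψ} : φ.Sentence → Prf L Γ (insert φ Δ) ψ → Prf L Γ Δ (.imp φ ψ)
  | impElim {Γ Δ φ ψ} : Prf L Γ Δ φ → Prf L Γ ∅ (.imp φ ψ) → Prf L Γ Δ ψ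
  | intTrans {Γ Δ φ ψ χ} : Prf L Γ Δ (.imp φ ψ) → Prf L Γ Δ (.imp ψ χ) →
      Prf L Γ Δ (.imp φ χ)
  | intAndIntro {Γ Δ φ ψ χ} : Prf L Γ Δ (.imp φ ψ) → Prf L Γ Δ (.imp φ χ) →
      Prf L Γ Δ (.imp φ (.and ψ χ))
  | intOrElim {Γ Δ φ ψ χ} : Prf L Γ Δ (.imp φ χ) → Prf L Γ Δ (.imp ψ χ) →
      Prf L Γ Δ (.imp (.or φ ψ) χ)
  | intAllIntro {Γ Δ φ ψ} : φ.Sentence → Prf L Γ Δ (.all (.imp φ ψ)) →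
      Prf L Γ Δ (.imp φ (.all ψ))
  | intExElim {Γ Δ φ ψ} : ψ.Sentence → Prf L Γ Δ (.all (.imp φ ψ)) →
      Prf L Γ Δ (.imp (.ex φ) ψ)
  | allIntro {Γ Δ Γ' Δ' φ} {i : ℕ} : Γ' ⊆ Γ → Δ' ⊆ Δ → FreshIn i Γ' → FreshIn i Δ' →
      ¬ φ.OccC (Sum.inr i) → Prf L Γ' Δ' (subst0 φ (aconst L i)) → Prf L Γ Δ (.all φ)
  | allElim {Γ Δ φ} {t : Term L.plus} : t.Closed → Prf L Γ Δ (.all φ) →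
      Prf L Γ Δ (subst0 φ t)
  | cd {Γ Δ φ ψ} : φ.Sentence → Prf L Γ Δ (.all (.or φ ψ)) → Prf L Γ Δ (.or φ (.all ψ))
  | exIntro {Γ Δ φ} {t : Term L.plus} : t.Closed → (Formula.ex φ).Sentence →
      Prf L Γ Δ (subst0 φ t) → Prf L Γ Δ (.ex φ)
  | exElim {Γ Δ Γ' Δ' φ ψ} {i : ℕ} : Γ' ⊆ Γ → Δ' ⊆ Δ → FreshIn i Γ' → FreshIn i Δ' →
      ¬ φ.OccC (Sum.inr i) → ¬ ψ.OccC (Sum.inr i) → Prf L Γ Δ (.ex φ) →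
      Prf L Γ' (insert (subst0 φ (aconst L i)) Δ') ψ → Prf L Γ Δ ψ

/-- `Γ ⊢ φ`: there is a proof of `φ` from `Γ` in `NBQL_CD^r`. -/
def Prv (L : Signature) (Γ : Set (Formula L.plus)) (φ : Formula L.plus) : Prop :=
  Prf L Γ ∅ φ

end BQL

namespace BQL

/-- A prime saturated `BQL_CD^r`-theory: a set of `L⁺`-sentences which is consistent,
closed under `NBQL_CD^r` (`⊢`), and has the disjunction, existence and totality
properties. -/
def PSTr (L : Signature) (Γ : Set (Formula L.plus)) : Prop :=
  (∀ φ ∈ Γ, Formula.Sentence φ) ∧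
  Formula.bot ∉ Γ ∧
  (∀ φ : Formula L.plus, φ.Sentence → Prv L Γ φ → φ ∈ Γ) ∧
  (∀ φ ψ : Formula L.plus, Formula.or φ ψ ∈ Γ → φ ∈ Γ ∨ ψ ∈ Γ) ∧
  (∀ φ : Formula L.plus, Formula.ex φ ∈ Γ →
    ∃ t : Term L.plus, t.Closed ∧ subst0 φ t ∈ Γ) ∧
  (∀ φ : Formula L.plus, φ.ClosedAt 1 →
    (∀ t : Term L.plus, t.Closed → subst0 φ t ∈ Γ) → Formula.all φ ∈ Γ)

end BQL

namespace BQL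

section Substitution

variable {L : Signature}

theorem Term.shiftUp_closedAt {t : Term L} {k : ℕ} :
    t.shiftUp.ClosedAt (k + 1) ↔ t.ClosedAt k := by
  induction t with
  | var n => simp [Term.shiftUp, Term.ClosedAt]
  | const c => simp [Term.shiftUp, Term.ClosedAt]
  | func f ts ih => simp [Term.shiftUp, Term.ClosedAt, ih]

theorem Term.ClosedAt.applySub {t : Term L} {k m : ℕ} {σ : ℕ → Term L} (ht : t.ClosedAt k)
    (hσ : ∀ n < k, (σ n).ClosedAt m) : (t.applySub σ).ClosedAt m := by
  induction t with
  | var n => exact hσ n ht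
  | const c => trivial
  | func f ts ih => exact fun i => ih i (ht i)

theorem Term.ClosedAt.of_applySub {t : Term L} {k m : ℕ} {σ : ℕ → Term L}
    (ht : (t.applySub σ).ClosedAt m) (hσ : ∀ n, (σ n).ClosedAt m → n < k) : t.ClosedAt k := by
  induction t with
  | var n => exact hσ n ht
  | const c => trivial
  | func f ts ih => exact fun i => ih i (ht i)

theorem Term.ClosedAt.applySub_eq {t : Term L} {k : ℕ} {σ : ℕ → Term L} (ht : t.ClosedAt k)
    (hσ : ∀ n < k, σ n = .var n) : t.applySub σ = t := by
  induction t with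
  | var n => exact hσ n ht
  | const c => rfl
  | func f ts ih =>
    simp only [Term.applySub]
    congr 1
    funext i
    exact ih i (ht i)

theorem Formula.ClosedAt.applySub {φ : Formula L} {k m : ℕ} {σ : ℕ → Term L}
    (hφ : φ.ClosedAt k) (hσ : ∀ n < k, (σ n).ClosedAt m) : (φ.applySub σ).ClosedAt m := by
  have lift : ∀ {k m : ℕ} {σ : ℕ → Term L}, (∀ n < k, (σ n).ClosedAt m) →
      ∀ n < k + 1, (liftSub σ n).ClosedAt (m + 1) := by
    intro k m σ hσ n hn
    cases n with
    | zero => exact Nat.succ_pos m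
    | succ n => exact Term.shiftUp_closedAt.2 (hσ n (by omega))
  induction φ generalizing k m σ with
  | top => trivial
  | bot => trivial
  | rel R ts => exact fun i => (hφ i).applySub hσ
  | and a b iha ihb => exact ⟨iha hφ.1 hσ, ihb hφ.2 hσ⟩
  | or a b iha ihb => exact ⟨iha hφ.1 hσ, ihb hφ.2 hσ⟩
  | imp a b iha ihb => exact ⟨iha hφ.1 hσ, ihb hφ.2 hσ⟩
  | all a ih => exact ih (k := k + 1) (m := m + 1) hφ (lift hσ)
  | ex a ih => exact ih (k := k + 1) (m := m + 1) hφ (lift hσ)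

theorem Formula.ClosedAt.of_applySub {φ : Formula L} {k m : ℕ} {σ : ℕ → Term L}
    (hφ : (φ.applySub σ).ClosedAt m) (hσ : ∀ n, (σ n).ClosedAt m → n < k) : φ.ClosedAt k := by
  have lift : ∀ {k m : ℕ} {σ : ℕ → Term L}, (∀ n, (σ n).ClosedAt m → n < k) →
      ∀ n, (liftSub σ n).ClosedAt (m + 1) → n < k + 1 := by
    intro k m σ hσ n hn
    cases n with
    | zero => exact Nat.succ_pos k
    | succ n => exact Nat.succ_lt_succ (hσ n (Term.shiftUp_closedAt.1 hn))
  induction φ generalizing k m σ with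
  | top => trivial
  | bot => trivial
  | rel R ts => exact fun i => (hφ i).of_applySub hσ
  | and a b iha ihb => exact ⟨iha hφ.1 hσ, ihb hφ.2 hσ⟩
  | or a b iha ihb => exact ⟨iha hφ.1 hσ, ihb hφ.2 hσ⟩
  | imp a b iha ihb => exact ⟨iha hφ.1 hσ, ihb hφ.2 hσ⟩
  | all a ih => exact ih (k := k + 1) (m := m + 1) hφ (lift hσ)
  | ex a ih => exact ih (k := k + 1) (m := m + 1) hφ (lift hσ)

theorem Formula.ClosedAt.applySub_eq {φ : Formula L} {k : ℕ} {σ : ℕ → Term L}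
    (hφ : φ.ClosedAt k) (hσ : ∀ n < k, σ n = .var n) : φ.applySub σ = φ := by
  have lift : ∀ {k : ℕ} {σ : ℕ → Term L}, (∀ n < k, σ n = .var n) →
      ∀ n < k + 1, liftSub σ n = .var n := by
    intro k σ hσ n hn
    cases n with
    | zero => rfl
    | succ n => simp [liftSub, hσ n (by omega), Term.shiftUp]
  induction φ generalizing k σ with
  | top => rfl
  | bot => rfl
  | rel R ts =>
    simp only [Formula.applySub]
    congr 1
    funext i
    exact (hφ i).applySub_eq hσ
  | and a b iha ihb => simp only [Formula.applySub, iha hφ.1 hσ, ihb hφ.2 hσ]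
  | or a b iha ihb => simp only [Formula.applySub, iha hφ.1 hσ, ihb hφ.2 hσ]
  | imp a b iha ihb => simp only [Formula.applySub, iha hφ.1 hσ, ihb hφ.2 hσ]
  | all a ih => simp only [Formula.applySub, ih (k := k + 1) hφ (lift hσ)]
  | ex a ih => simp only [Formula.applySub, ih (k := k + 1) hφ (lift hσ)]

theorem Formula.Sentence.subst0_eq {φ : Formula L} (hφ : φ.Sentence) (t : Term L) :
    subst0 φ t = φ :=
  Formula.ClosedAt.applySub_eq hφ fun _ hn => absurd hn (Nat.not_lt_zero _)

theorem Formula.Sentence.closedAt_one {φ : Formula L} (hφ : φ.Sentence) : φ.ClosedAt 1 := by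
  rw [← hφ.subst0_eq (.var 0)]
  exact Formula.ClosedAt.applySub hφ fun _ hn => absurd hn (Nat.not_lt_zero _)

theorem Formula.ClosedAt.subst0 {φ : Formula L} {t : Term L} (hφ : φ.ClosedAt 1)
    (ht : t.Closed) : (subst0 φ t).Sentence := by
  refine Formula.ClosedAt.applySub hφ fun n hn => ?_
  obtain rfl : n = 0 := by omega
  exact ht

theorem Formula.Sentence.of_subst0 {φ : Formula L} {t : Term L} (h : (BQL.subst0 φ t).Sentence) :
    φ.ClosedAt 1 := by
  refine Formula.ClosedAt.of_applySub h fun n hn => ?_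
  cases n with
  | zero => exact Nat.one_pos
  | succ n => exact absurd hn (Nat.not_lt_zero n)

theorem boxN_closedAt {n k : ℕ} {φ : Formula L} : (boxN n φ).ClosedAt k ↔ φ.ClosedAt k := by
  induction n with
  | zero => rfl
  | succ n ih => simp [boxN, Formula.ClosedAt, ih]

theorem boxN_occC {n : ℕ} {c : L.Const} {φ : Formula L} : (boxN n φ).OccC c ↔ φ.OccC c := by
  induction n with
  | zero => rfl
  | succ n ih => simp [boxN, Formula.OccC, ih]

theorem boxN_boxN (m n : ℕ) (φ : Formula L) : boxN m (boxN n φ) = boxN (m + n) φ := by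
  induction m with
  | zero => simp [boxN]
  | succ m ih => rw [Nat.succ_add, boxN, ih, boxN]

theorem subst0_boxN (n : ℕ) (φ : Formula L) (t : Term L) :
    subst0 (boxN n φ) t = boxN n (subst0 φ t) := by
  induction n with
  | zero => rfl
  | succ n ih => exact congrArg (Formula.imp .top) ih

theorem Term.finite_occC {t : Term L.plus} : {i : ℕ | t.OccC (Sum.inr i)}.Finite := by
  induction t with
  | var n => simp [Term.OccC]
  | const c =>
    refine Set.Subsingleton.finite fun i hi j hj => ?_
    exact Sum.inr_injective (Eq.trans (Eq.symm hi) hj)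
  | func f ts ih => simpa [Term.OccC, Set.ofPred_exists] using Set.finite_iUnion ih

theorem Formula.finite_occC (φ : Formula L.plus) : {i : ℕ | φ.OccC (Sum.inr i)}.Finite := by
  induction φ with
  | top => simp [Formula.OccC]
  | bot => simp [Formula.OccC]
  | rel R ts =>
    simpa [Formula.OccC, Set.ofPred_exists] using
      Set.finite_iUnion fun i => Term.finite_occC (t := ts i)
  | and a b iha ihb => simpa [Formula.OccC, Set.ofPred_or] using iha.union ihb
  | or a b iha ihb => simpa [Formula.OccC, Set.ofPred_or] using iha.union ihb
  | imp a b iha ihb => simpa [Formula.OccC, Set.ofPred_or] using iha.union ihb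
  | all a ih => exact ih
  | ex a ih => exact ih

theorem aconst_closed (i : ℕ) : (aconst L i).Closed := trivial

end Substitution

section Countability

variable {L : Signature}

/-- Number of arguments of a node of the syntax tree of a term. -/
def termArity (L : Signature) : (ℕ ⊕ L.Const) ⊕ L.Func → ℕ
  | .inl _ => 0
  | .inr f => L.arityF f

/-- The term with a given syntax tree. -/
def Term.ofTree : WType (fun s => Fin (termArity L s)) → Term L
  | ⟨.inl (.inl n), _⟩ => .var n
  | ⟨.inl (.inr c), _⟩ => .const c
  | ⟨.inr f, ts⟩ => .func f fun i => ofTree (ts i)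

theorem Term.ofTree_surjective : Function.Surjective (Term.ofTree (L := L)) := by
  intro t
  induction t with
  | var n => exact ⟨⟨.inl (.inl n), Fin.elim0⟩, rfl⟩
  | const c => exact ⟨⟨.inl (.inr c), Fin.elim0⟩, rfl⟩
  | func f ts ih =>
    choose us hus using ih
    obtain rfl : (fun i => ofTree (us i)) = ts := funext hus
    exact ⟨⟨.inr f, us⟩, rfl⟩

theorem Term.countable [Countable L.Const] [Countable L.Func] : Countable (Term L) := by
  have := Encodable.ofCountable ((ℕ ⊕ L.Const) ⊕ L.Func)
  exact Term.ofTree_surjective.countable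

/-- Number of children of a node of the syntax tree of a formula: the left summand labels the
atomic formulas, the right one the connectives and quantifiers, all of them given two children. -/
def formulaArity (L : Signature) :
    (Bool ⊕ Σ R : L.Rel, Fin (L.arityR R) → Term L) ⊕ ℕ → ℕ
  | .inl _ => 0
  | .inr _ => 2

/-- The formula with a given syntax tree; the second child of a quantifier is ignored. -/
def Formula.ofTree : WType (fun s => Fin (formulaArity L s)) → Formula L
  | ⟨.inl (.inl true), _⟩ => .top
  | ⟨.inl (.inl false), _⟩ => .bot
  | ⟨.inl (.inr ⟨R, ts⟩), _⟩ => .rel R ts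
  | ⟨.inr 0, f⟩ => .and (ofTree (f (0 : Fin 2))) (ofTree (f (1 : Fin 2)))
  | ⟨.inr 1, f⟩ => .or (ofTree (f (0 : Fin 2))) (ofTree (f (1 : Fin 2)))
  | ⟨.inr 2, f⟩ => .imp (ofTree (f (0 : Fin 2))) (ofTree (f (1 : Fin 2)))
  | ⟨.inr 3, f⟩ => .all (ofTree (f (0 : Fin 2)))
  | ⟨.inr (_ + 4), f⟩ => .ex (ofTree (f (0 : Fin 2)))

theorem Formula.ofTree_surjective : Function.Surjective (Formula.ofTree (L := L)) := by
  intro φ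
  induction φ with
  | top => exact ⟨⟨.inl (.inl true), Fin.elim0⟩, rfl⟩
  | bot => exact ⟨⟨.inl (.inl false), Fin.elim0⟩, rfl⟩
  | rel R ts => exact ⟨⟨.inl (.inr ⟨R, ts⟩), Fin.elim0⟩, rfl⟩
  | and a b iha ihb =>
    obtain ⟨s, rfl⟩ := iha
    obtain ⟨t, rfl⟩ := ihb
    exact ⟨⟨.inr 0, ![s, t]⟩, rfl⟩
  | or a b iha ihb =>
    obtain ⟨s, rfl⟩ := iha
    obtain ⟨t, rfl⟩ := ihb
    exact ⟨⟨.inr 1, ![s, t]⟩, rfl⟩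
  | imp a b iha ihb =>
    obtain ⟨s, rfl⟩ := iha
    obtain ⟨t, rfl⟩ := ihb
    exact ⟨⟨.inr 2, ![s, t]⟩, rfl⟩
  | all a ih =>
    obtain ⟨s, rfl⟩ := ih
    exact ⟨⟨.inr 3, ![s, s]⟩, rfl⟩
  | ex a ih =>
    obtain ⟨s, rfl⟩ := ih
    exact ⟨⟨.inr 4, ![s, s]⟩, rfl⟩

theorem Formula.countable [Countable L.Const] [Countable L.Func] [Countable L.Rel] :
    Countable (Formula L) := by
  have := Term.countable (L := L)
  have := Encodable.ofCountable ((Bool ⊕ Σ R : L.Rel, Fin (L.arityR R) → Term L) ⊕ ℕ)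
  exact Formula.ofTree_surjective.countable

end Countability

section Derivations

variable {L : Signature} {Γ Δ : Set (Formula L.plus)} {a b c d γ δ θ : Formula L.plus}

theorem Prf.sentence (h : Prf L Γ Δ θ) : θ.Sentence := by
  induction h with
  | hyp _ h => exact h
  | weaken _ _ _ ih => exact ih
  | topIntro => trivial
  | botElim h _ _ => exact h
  | andIntro _ _ ih₁ ih₂ => exact ⟨ih₁, ih₂⟩
  | andElimL _ ih => exact ih.1
  | andElimR _ ih => exact ih.2
  | orIntroL h _ ih => exact ⟨ih, h⟩
  | orIntroR h _ ih => exact ⟨h, ih⟩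
  | orElim _ _ _ _ ih _ => exact ih
  | impIntro h _ ih => exact ⟨h, ih⟩
  | impElim _ _ _ ih => exact ih.2
  | intTrans _ _ ih₁ ih₂ => exact ⟨ih₁.1, ih₂.2⟩
  | intAndIntro _ _ ih₁ ih₂ => exact ⟨ih₁.1, ih₁.2, ih₂.2⟩
  | intOrElim _ _ ih₁ ih₂ => exact ⟨⟨ih₁.1, ih₂.1⟩, ih₁.2⟩
  | intAllIntro h _ ih => exact ⟨h, And.right (a := Formula.ClosedAt _ 1) ih⟩
  | intExElim h _ ih => exact ⟨And.left (b := Formula.ClosedAt _ 1) ih, h⟩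
  | allIntro _ _ _ _ _ _ ih => exact Formula.Sentence.of_subst0 ih
  | allElim ht _ ih => exact Formula.ClosedAt.subst0 ih ht
  | cd h _ ih => exact ⟨h, And.right (a := Formula.ClosedAt _ 1) ih⟩
  | exIntro _ h _ _ => exact h
  | exElim _ _ _ _ _ _ _ _ _ ih => exact ih

/-- `b` has a proof from the single assumption `a` in which `a` is only used safely. -/
def Ent (a b : Formula L.plus) : Prop := Prf L ∅ (insert a ∅) b

theorem Ent.imp (ha : a.Sentence) (e : Ent a b) : Prf L Γ Δ (a.imp b) :=
  .weaken (Set.empty_subset _) (Set.empty_subset _) (.impIntro ha e)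

theorem Prf.cut (h : Prf L Γ Δ a) (e : Ent a b) : Prf L Γ Δ b :=
  .impElim h (e.imp h.sentence)

theorem Prf.head (ha : a.Sentence) : Prf L Γ (insert a Δ) a := .hyp (by simp) ha

theorem Prf.under (h : Prf L Γ Δ b) : Prf L Γ (insert a Δ) b :=
  .weaken subset_rfl (Set.subset_insert _ _) h

theorem Ent.refl (ha : a.Sentence) : Ent a a := Prf.head ha

theorem Ent.trans (h : Ent a b) (e : Ent b c) : Ent a c := Prf.cut h e

theorem Ent.fst (ha : a.Sentence) (hb : b.Sentence) : Ent (a.and b) a :=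
  .andElimL (Prf.head ⟨ha, hb⟩)

theorem Ent.snd (ha : a.Sentence) (hb : b.Sentence) : Ent (a.and b) b :=
  .andElimR (Prf.head ⟨ha, hb⟩)

theorem Prf.imp_trans (h : Prf L Γ Δ (a.imp b)) (e : Ent b c) : Prf L Γ Δ (a.imp c) :=
  .intTrans h (e.imp h.sentence.2)

theorem Prf.trans_imp (ha : a.Sentence) (e : Ent a b) (h : Prf L Γ Δ (b.imp c)) :
    Prf L Γ Δ (a.imp c) :=
  .intTrans (e.imp ha) h

theorem Prf.boxN (n : ℕ) (h : Prf L Γ Δ a) : Prf L Γ Δ (boxN n a) := by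
  induction n with
  | zero => exact h
  | succ n ih => exact .impIntro trivial ih.under

theorem Prf.unbox {n : ℕ} (h : Prf L Γ ∅ (BQL.boxN n a)) : Prf L Γ ∅ a := by
  induction n with
  | zero => exact h
  | succ n ih => exact ih (.impElim .topIntro h)

theorem Ent.boxN_mono (n : ℕ) (ha : a.Sentence) (e : Ent a b) : Ent (boxN n a) (boxN n b) := by
  induction n with
  | zero => exact e
  | succ n ih => exact Prf.imp_trans (Prf.head ⟨trivial, boxN_closedAt.2 ha⟩) ih

theorem Prf.box_cut {n : ℕ} (h : Prf L Γ Δ (BQL.boxN n a)) (e : Ent a b) :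
    Prf L Γ Δ (BQL.boxN n b) :=
  h.cut (e.boxN_mono n (boxN_closedAt.1 h.sentence))

theorem Ent.boxN_and (n : ℕ) (ha : a.Sentence) (hb : b.Sentence) :
    Ent ((boxN n a).and (boxN n b)) (boxN n (a.and b)) := by
  induction n with
  | zero => exact Ent.refl ⟨ha, hb⟩
  | succ n ih =>
    have ha' : (boxN (n + 1) a).Sentence := boxN_closedAt.2 ha
    have hb' : (boxN (n + 1) b).Sentence := boxN_closedAt.2 hb
    exact Prf.imp_trans (.intAndIntro (Ent.fst ha' hb') (Ent.snd ha' hb')) ih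

theorem Ent.all_boxN (n : ℕ) (ha : a.ClosedAt 1) :
    Ent (boxN n a).all (boxN n a.all) := by
  induction n with
  | zero => exact Ent.refl ha
  | succ n ih =>
    have h : (boxN (n + 1) a).all.Sentence := boxN_closedAt (n := n + 1) (k := 1).2 ha
    exact Prf.imp_trans (.intAllIntro trivial (Prf.head h)) ih

/-- Two boxed consequences of `γ` and `δ` may be combined. -/
theorem Ent.box_combine {m n : ℕ} (hγ : γ.Sentence) (hδ : δ.Sentence) (h₁ : Ent γ (boxN m a))
    (h₂ : Ent δ (boxN n b)) (e : Ent (a.and b) c) : Ent (γ.and δ) (boxN (n + m) c) := by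
  have ha : a.Sentence := boxN_closedAt.1 h₁.sentence
  have hb : b.Sentence := boxN_closedAt.1 h₂.sentence
  have h₁' : Ent (γ.and δ) (boxN (n + m) a) := by
    rw [← boxN_boxN]
    exact ((Ent.fst hγ hδ).trans h₁).boxN n
  have h₂' : Ent (γ.and δ) (boxN (n + m) b) := by
    rw [Nat.add_comm, ← boxN_boxN]
    exact ((Ent.snd hγ hδ).trans h₂).boxN m
  exact Prf.box_cut ((Prf.andIntro h₁' h₂').cut (Ent.boxN_and _ ha hb)) e

/-- Conjunctions of finitely many sentences of `Δ`. -/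
inductive ConjOf (S : Set (Formula L.plus)) : Formula L.plus → Prop
  | top : ConjOf S .top
  | mem {φ} : φ ∈ S → φ.Sentence → ConjOf S φ
  | and {φ ψ} : ConjOf S φ → ConjOf S ψ → ConjOf S (.and φ ψ)

theorem ConjOf.sentence (h : ConjOf Δ a) : a.Sentence := by
  induction h with
  | top => trivial
  | mem _ h => exact h
  | and _ _ ih₁ ih₂ => exact ⟨ih₁, ih₂⟩

theorem ConjOf.mono {Δ' : Set (Formula L.plus)} (hs : Δ ⊆ Δ') (h : ConjOf Δ a) :
    ConjOf Δ' a := by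
  induction h with
  | top => exact .top
  | mem hm h => exact .mem (hs hm) h
  | and _ _ ih₁ ih₂ => exact .and ih₁ ih₂

theorem ConjOf.fresh {i : ℕ} (hf : FreshIn i Δ) (h : ConjOf Δ a) : ¬ a.OccC (Sum.inr i) := by
  induction h with
  | top => exact id
  | mem hm _ => exact hf _ hm
  | and _ _ ih₁ ih₂ => exact fun h => h.elim ih₁ ih₂

theorem ConjOf.prf (h : ConjOf Γ a) : Prf L Γ Δ a := by
  induction h with
  | top => exact .topIntro
  | mem hm h => exact .hyp (.inl hm) h
  | and _ _ ih₁ ih₂ => exact .andIntro ih₁ ih₂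

theorem ConjOf.insert (hb : b.Sentence) (h : ConjOf (insert b Δ) a) :
    ∃ d, ConjOf Δ d ∧ Ent (d.and b) a := by
  induction h with
  | top => exact ⟨.top, .top, .topIntro⟩
  | mem hm h =>
    rcases hm with rfl | hm
    · exact ⟨.top, .top, Ent.snd trivial hb⟩
    · exact ⟨_, .mem hm h, Ent.fst h hb⟩
  | and _ _ ih₁ ih₂ =>
    obtain ⟨d₁, h₁, e₁⟩ := ih₁
    obtain ⟨d₂, h₂, e₂⟩ := ih₂
    have s₁ := h₁.sentence
    have s₂ := h₂.sentence
    have f := Ent.fst (a := d₁.and d₂) ⟨s₁, s₂⟩ hb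
    have s := Ent.snd (a := d₁.and d₂) ⟨s₁, s₂⟩ hb
    exact ⟨d₁.and d₂, .and h₁ h₂, .andIntro
      (Prf.cut (.andIntro (.andElimL f) s) e₁) (Prf.cut (.andIntro (.andElimR f) s) e₂)⟩

theorem ConjOf.exists_of_iUnion {G : ℕ → Set (Formula L.plus)} (hG : Monotone G)
    (h : ConjOf (⋃ n, G n) a) : ∃ n, ConjOf (G n) a := by
  induction h with
  | top => exact ⟨0, .top⟩
  | mem hm h =>
    obtain ⟨n, hn⟩ := Set.mem_iUnion.1 hm
    exact ⟨n, .mem hn h⟩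
  | and _ _ ih₁ ih₂ =>
    obtain ⟨m, hm⟩ := ih₁
    obtain ⟨n, hn⟩ := ih₂
    exact ⟨max m n, .and (hm.mono (hG (le_max_left m n))) (hn.mono (hG (le_max_right m n)))⟩

/-- `θ` follows from `Γ : Δ` by safe reasoning from finitely many members of `Γ`, up to
finitely many boxes, with the assumptions in `Δ` internalized. -/
def SafeForm (Γ Δ : Set (Formula L.plus)) (θ : Formula L.plus) : Prop :=
  ∃ γ δ n, ConjOf Γ γ ∧ ConjOf Δ δ ∧ Ent γ (boxN n (δ.imp θ))

theorem SafeForm.cut (h : SafeForm Γ Δ a) (e : Ent a b) : SafeForm Γ Δ b := by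
  obtain ⟨γ, δ, n, hγ, hδ, h⟩ := h
  have s : (δ.imp a).Sentence := boxN_closedAt.1 h.sentence
  exact ⟨γ, δ, n, hγ, hδ, h.box_cut (Prf.imp_trans (Prf.head s) e)⟩

theorem SafeForm.and (h₁ : SafeForm Γ Δ a) (h₂ : SafeForm Γ Δ b) : SafeForm Γ Δ (a.and b) := by
  obtain ⟨γ₁, δ₁, m, hγ₁, hδ₁, h₁⟩ := h₁
  obtain ⟨γ₂, δ₂, n, hγ₂, hδ₂, h₂⟩ := h₂
  have s₁ : (δ₁.imp a).Sentence := boxN_closedAt.1 h₁.sentence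
  have s₂ : (δ₂.imp b).Sentence := boxN_closedAt.1 h₂.sentence
  refine ⟨_, _, _, hγ₁.and hγ₂, hδ₁.and hδ₂, Ent.box_combine hγ₁.sentence hγ₂.sentence h₁ h₂ ?_⟩
  exact .intAndIntro
    (Prf.trans_imp ⟨s₁.1, s₂.1⟩ (Ent.fst s₁.1 s₂.1) (Ent.fst s₁ s₂))
    (Prf.trans_imp ⟨s₁.1, s₂.1⟩ (Ent.snd s₁.1 s₂.1) (Ent.snd s₁ s₂))

theorem Ent.curry_imp (ha : a.Sentence) (hb : b.Sentence) (hc : c.Sentence) :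
    Ent ((a.and b).imp c) (a.imp (b.imp c)) := by
  have s : ((a.and b).imp c).Sentence := ⟨⟨ha, hb⟩, hc⟩
  refine .impIntro ha (Prf.intTrans (ψ := a.and b) ?_ (Prf.head s).under)
  exact .impIntro hb (.andIntro (Prf.head ha).under (Prf.head hb))

theorem SafeForm.impIntro (ha : a.Sentence) (h : SafeForm Γ (insert a Δ) b) :
    SafeForm Γ Δ (a.imp b) := by
  obtain ⟨γ, δ', n, hγ, hδ', h⟩ := h
  obtain ⟨δ, hδ, e⟩ := hδ'.insert ha
  have s : (δ'.imp b).Sentence := boxN_closedAt.1 h.sentence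
  refine ⟨γ, δ, n, hγ, hδ, h.box_cut ?_⟩
  exact Prf.cut (Prf.trans_imp (a := δ.and a) ⟨hδ.sentence, ha⟩ e (Prf.head s))
    (Ent.curry_imp hδ.sentence ha s.2)

theorem SafeForm.impElim (h₁ : SafeForm Γ Δ a) (h₂ : SafeForm Γ ∅ (a.imp b)) :
    SafeForm Γ Δ b := by
  obtain ⟨γ₁, δ, m, hγ₁, hδ, h₁⟩ := h₁
  obtain ⟨γ₂, δ₀, n, hγ₂, hδ₀, h₂⟩ := h₂
  have s₁ : (δ.imp a).Sentence := boxN_closedAt.1 h₁.sentence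
  have s₂ : (δ₀.imp (a.imp b)).Sentence := boxN_closedAt.1 h₂.sentence
  refine ⟨_, δ, n + m + 1, hγ₁.and hγ₂, hδ, ?_⟩
  rw [← boxN_boxN]
  refine Ent.box_combine hγ₁.sentence hγ₂.sentence h₁ h₂ ?_
  refine Prf.imp_trans (b := (δ.imp a).and (a.imp b)) (.intAndIntro ?_ ?_)
    (.intTrans (Ent.fst s₁ s₂.2) (Ent.snd s₁ s₂.2))
  · exact (Ent.fst s₁ s₂).boxN 1
  · exact Prf.trans_imp trivial hδ₀.prf (Ent.snd s₁ s₂)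

theorem Ent.and_or (ha : a.Sentence) (hb : b.Sentence) (hc : c.Sentence) :
    Ent (a.and (b.or c)) ((a.and b).or (a.and c)) := by
  have s : (a.and (b.or c)).Sentence := ⟨ha, hb, hc⟩
  refine .orElim (Ent.snd (b := b.or c) ha ⟨hb, hc⟩) ?_ ?_
  · exact .orIntroL ⟨ha, hc⟩ (.andIntro (Ent.fst (b := b.or c) ha ⟨hb, hc⟩).under (Prf.head hb))
  · exact .orIntroR ⟨ha, hb⟩ (.andIntro (Ent.fst (b := b.or c) ha ⟨hb, hc⟩).under (Prf.head hc))

theorem SafeForm.orElim (h : SafeForm Γ Δ (a.or b)) (h₁ : SafeForm Γ (insert a Δ) c)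
    (h₂ : SafeForm Γ (insert b Δ) c) : SafeForm Γ Δ c := by
  obtain ⟨γ, δ, n, hγ, hδ, h⟩ := h
  obtain ⟨γ₁, δ₁', n₁, hγ₁, hδ₁', h₁⟩ := h₁
  obtain ⟨γ₂, δ₂', n₂, hγ₂, hδ₂', h₂⟩ := h₂
  have s : (δ.imp (a.or b)).Sentence := boxN_closedAt.1 h.sentence
  have sa := s.2.1
  have sb := s.2.2
  obtain ⟨δ₁, hδ₁, e₁⟩ := hδ₁'.insert sa
  obtain ⟨δ₂, hδ₂, e₂⟩ := hδ₂'.insert sb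
  have s₁ : (δ₁'.imp c).Sentence := boxN_closedAt.1 h₁.sentence
  have s₂ : (δ₂'.imp c).Sentence := boxN_closedAt.1 h₂.sentence
  have sδ := hδ.sentence
  have sδ₁ := hδ₁.sentence
  have sδ₂ := hδ₂.sentence
  refine ⟨_, _, _, hγ.and (hγ₁.and hγ₂), hδ.and (hδ₁.and hδ₂),
    Ent.box_combine hγ.sentence ⟨hγ₁.sentence, hγ₂.sentence⟩ h
      (Ent.box_combine hγ₁.sentence hγ₂.sentence h₁ h₂ (Ent.refl ⟨s₁, s₂⟩)) ?_⟩
  set D := δ.and (δ₁.and δ₂)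
  have sD : D.Sentence := ⟨sδ, sδ₁, sδ₂⟩
  have d : Ent D δ := Ent.fst sδ ⟨sδ₁, sδ₂⟩
  have d₁ : Ent D δ₁ := .andElimL (Ent.snd sδ ⟨sδ₁, sδ₂⟩)
  have d₂ : Ent D δ₂ := .andElimR (Ent.snd sδ ⟨sδ₁, sδ₂⟩)
  have k : Ent ((δ.imp (a.or b)).and ((δ₁'.imp c).and (δ₂'.imp c)))
      ((δ₁'.imp c).and (δ₂'.imp c)) := Ent.snd s ⟨s₁, s₂⟩
  have ka := Prf.trans_imp (a := D.and a) ⟨sD, sa⟩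
    (Prf.cut (.andIntro ((Ent.fst sD sa).trans d₁) (Ent.snd sD sa)) e₁) (.andElimL k)
  have kb := Prf.trans_imp (a := D.and b) ⟨sD, sb⟩
    (Prf.cut (.andIntro ((Ent.fst sD sb).trans d₂) (Ent.snd sD sb)) e₂) (.andElimR k)
  refine .intTrans ?_ (.intOrElim ka kb)
  refine Prf.imp_trans (.intAndIntro ((Ent.refl sD).imp sD) ?_) (Ent.and_or sD sa sb)
  exact Prf.trans_imp sD d (Ent.fst s ⟨s₁, s₂⟩)

theorem SafeForm.allIntro {Γ' Δ' : Set (Formula L.plus)} {i : ℕ} (hΓ : Γ' ⊆ Γ) (hΔ : Δ' ⊆ Δ)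
    (fΓ : FreshIn i Γ') (fΔ : FreshIn i Δ') (fa : ¬ a.OccC (Sum.inr i))
    (h : SafeForm Γ' Δ' (subst0 a (aconst L i))) : SafeForm Γ Δ a.all := by
  obtain ⟨γ, δ, n, hγ, hδ, h⟩ := h
  have s : (δ.imp (subst0 a (aconst L i))).Sentence := boxN_closedAt.1 h.sentence
  have sδ := hδ.sentence
  have sa : a.ClosedAt 1 := Formula.Sentence.of_subst0 s.2
  have eq : subst0 (boxN n (δ.imp a)) (aconst L i) = boxN n (δ.imp (subst0 a (aconst L i))) := by
    rw [subst0_boxN]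
    exact congrArg (fun x => boxN n (.imp x _)) (sδ.subst0_eq _)
  have sI : (δ.imp a).ClosedAt 1 := ⟨sδ.closedAt_one, sa⟩
  refine ⟨γ, δ, n, hγ.mono hΓ, hδ.mono hΔ, ?_⟩
  have key : Ent γ (boxN n (δ.imp a)).all := by
    refine .allIntro (i := i) subset_rfl subset_rfl (fun _ h => absurd h (Set.notMem_empty _)) ?_
      ?_ (eq ▸ h)
    · simpa [FreshIn] using hγ.fresh fΓ
    · exact mt boxN_occC.1 fun h => h.elim (hδ.fresh fΔ) fa
  refine (key.trans (Ent.all_boxN n sI)).box_cut ?_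
  exact .intAllIntro sδ (Prf.head sI)

theorem Ent.and_ex {i : ℕ} (ha : a.Sentence) (hb : b.ClosedAt 1) (fa : ¬ a.OccC (Sum.inr i))
    (fb : ¬ b.OccC (Sum.inr i)) : Ent (a.and b.ex) (a.and b).ex := by
  have s : (a.and b.ex).Sentence := ⟨ha, hb⟩
  have st := hb.subst0 (aconst_closed (L := L) i)
  refine .exElim (i := i) subset_rfl subset_rfl (fun _ h => absurd h (Set.notMem_empty _)) ?_
    fb (fun h => h.elim fa fb) (Ent.snd ha hb) ?_
  · rintro _ (rfl | h)
    · exact fun h => h.elim fa fb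
    · exact absurd h (Set.notMem_empty _)
  · refine .exIntro (t := aconst L i) (aconst_closed i) ⟨ha.closedAt_one, hb⟩ ?_
    have eq : subst0 (a.and b) (aconst L i) = a.and (subst0 b (aconst L i)) :=
      congrArg (fun x => Formula.and x _) (ha.subst0_eq _)
    rw [eq]
    exact .andIntro (Ent.fst (b := b.ex) ha hb).under (Prf.head st)

theorem SafeForm.exElim {Γ' Δ' : Set (Formula L.plus)} {i : ℕ} (hΓ : Γ' ⊆ Γ) (hΔ : Δ' ⊆ Δ)
    (fΓ : FreshIn i Γ') (fΔ : FreshIn i Δ') (fa : ¬ a.OccC (Sum.inr i))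
    (fb : ¬ b.OccC (Sum.inr i)) (hex : SafeForm Γ Δ a.ex)
    (h : SafeForm Γ' (insert (subst0 a (aconst L i)) Δ') b) : SafeForm Γ Δ b := by
  obtain ⟨γ₁, δ₁, m, hγ₁, hδ₁, h₁⟩ := hex
  have s₁ : (δ₁.imp a.ex).Sentence := boxN_closedAt.1 h₁.sentence
  have sa : a.ClosedAt 1 := s₁.2
  have st := sa.subst0 (aconst_closed (L := L) i)
  obtain ⟨γ, δ', n, hγ, hδ', h⟩ := h
  obtain ⟨δ, hδ, e⟩ := hδ'.insert st
  have s : (δ'.imp b).Sentence := boxN_closedAt.1 h.sentence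
  have sb : b.Sentence := s.2
  have sδ := hδ.sentence
  have all : SafeForm Γ ∅ ((δ.and a).imp b).all := by
    refine .allIntro (i := i) hΓ subset_rfl fΓ (fun _ h => absurd h (Set.notMem_empty _))
      (fun h => h.elim (fun h => h.elim (hδ.fresh fΔ) fa) fb) ?_
    have eq : subst0 ((δ.and a).imp b) (aconst L i) = (δ.and (subst0 a (aconst L i))).imp b :=
      congrArg₂ (fun x y => Formula.imp (.and x _) y) (sδ.subst0_eq _)
        (Formula.Sentence.subst0_eq sb _)
    rw [eq]
    refine ⟨γ, .top, n, hγ, .top, h.box_cut ?_⟩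
    exact .impIntro trivial (Prf.trans_imp ⟨sδ, st⟩ e (Prf.head s).under)
  have sall : ((δ.and a).imp b).all.Sentence := ⟨⟨sδ.closedAt_one, sa⟩, sb.closedAt_one⟩
  have imp := (all.cut (.intExElim sb (Prf.head sall))).cut
    (Prf.trans_imp (a := δ.and a.ex) ⟨sδ, sa⟩ (Ent.and_ex (i := i) sδ sa (hδ.fresh fΔ) fa)
      (Prf.head ⟨⟨sδ.closedAt_one, sa⟩, sb⟩))
  refine SafeForm.impElim (SafeForm.and ?_ ⟨γ₁, δ₁, m, hγ₁, hδ₁, h₁⟩) imp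
  exact ⟨.top, δ, 0, .top, hδ.mono hΔ, (Ent.refl sδ).imp sδ⟩

theorem Prf.safeForm (h : Prf L Γ Δ θ) : SafeForm Γ Δ θ := by
  induction h with
  | hyp hm h =>
    rcases hm with hm | hm
    · exact ⟨_, .top, 0, .mem hm h, .top, .impIntro trivial (Prf.head h).under⟩
    · exact ⟨.top, _, 0, .top, .mem hm h, (Ent.refl h).imp h⟩
  | weaken hΓ hΔ _ ih =>
    obtain ⟨γ, δ, n, hγ, hδ, h⟩ := ih
    exact ⟨γ, δ, n, hγ.mono hΓ, hδ.mono hΔ, h⟩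
  | topIntro => exact ⟨.top, .top, 0, .top, .top, .impIntro trivial .topIntro⟩
  | botElim h _ ih => exact ih.cut (.botElim h (Prf.head trivial))
  | andIntro _ _ ih₁ ih₂ => exact ih₁.and ih₂
  | andElimL h ih => exact ih.cut (.andElimL (Prf.head h.sentence))
  | andElimR h ih => exact ih.cut (.andElimR (Prf.head h.sentence))
  | orIntroL s h ih => exact ih.cut (.orIntroL s (Prf.head h.sentence))
  | orIntroR s h ih => exact ih.cut (.orIntroR s (Prf.head h.sentence))
  | orElim _ _ _ ih ih₁ ih₂ => exact ih.orElim ih₁ ih₂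
  | impIntro h _ ih => exact ih.impIntro h
  | impElim _ _ ih₁ ih₂ => exact ih₁.impElim ih₂
  | intTrans h₁ h₂ ih₁ ih₂ =>
    exact (ih₁.and ih₂).cut
      (.intTrans (Ent.fst h₁.sentence h₂.sentence) (Ent.snd h₁.sentence h₂.sentence))
  | intAndIntro h₁ h₂ ih₁ ih₂ =>
    exact (ih₁.and ih₂).cut
      (.intAndIntro (Ent.fst h₁.sentence h₂.sentence) (Ent.snd h₁.sentence h₂.sentence))
  | intOrElim h₁ h₂ ih₁ ih₂ =>
    exact (ih₁.and ih₂).cut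
      (.intOrElim (Ent.fst h₁.sentence h₂.sentence) (Ent.snd h₁.sentence h₂.sentence))
  | intAllIntro s h ih => exact ih.cut (.intAllIntro s (Prf.head h.sentence))
  | intExElim s h ih => exact ih.cut (.intExElim s (Prf.head h.sentence))
  | allIntro hΓ hΔ fΓ fΔ fa _ ih => exact ih.allIntro hΓ hΔ fΓ fΔ fa
  | allElim ht h ih => exact ih.cut (.allElim ht (Prf.head h.sentence))
  | cd s h ih => exact ih.cut (.cd s (Prf.head h.sentence))
  | exIntro ht s h ih => exact ih.cut (.exIntro ht s (Prf.head h.sentence))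
  | exElim hΓ hΔ fΓ fΔ fa fb _ _ ih₁ ih₂ => exact ih₁.exElim hΓ hΔ fΓ fΔ fa fb ih₂

/-- Provability from `Γ` amounts to safe provability up to boxes from finitely many members. -/
theorem Prv.exists_conj (h : Prv L Γ θ) : ∃ γ n, ConjOf Γ γ ∧ Ent γ (boxN n θ) := by
  obtain ⟨γ, δ, n, hγ, hδ, h⟩ := Prf.safeForm h
  have s : (δ.imp θ).Sentence := boxN_closedAt.1 h.sentence
  refine ⟨γ, n + 1, hγ, ?_⟩
  rw [← boxN_boxN]
  exact h.box_cut (Prf.trans_imp trivial hδ.prf (Prf.head s))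

/-- A general assumption can be used safely at the cost of boxing the conclusion. -/
theorem Prv.exists_safe (ha : a.Sentence) (h : Prv L (insert a Γ) θ) :
    ∃ n, ∀ m ≥ n, Prf L Γ (insert a ∅) (boxN m θ) := by
  obtain ⟨γ', n, hγ', h⟩ := h.exists_conj
  obtain ⟨γ, hγ, e⟩ := hγ'.insert ha
  refine ⟨n, fun m hm => ?_⟩
  obtain ⟨k, rfl⟩ := Nat.exists_eq_add_of_le' hm
  rw [← boxN_boxN]
  exact (Prf.cut (.andIntro hγ.prf (Prf.head ha)) (e.trans h)).boxN k

theorem Prv.mono {Γ' : Set (Formula L.plus)} (hs : Γ ⊆ Γ') (h : Prv L Γ θ) : Prv L Γ' θ :=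
  Prf.weaken hs subset_rfl h

theorem Prv.cut (h : Prv L Γ a) (h' : Prv L (insert a Γ) θ) : Prv L Γ θ := by
  obtain ⟨n, hn⟩ := h'.exists_safe (Prf.sentence h)
  exact Prf.unbox (.impElim h (.impIntro (Prf.sentence h) (hn n le_rfl)))

theorem Prv.or_elim (h : Prv L Γ (a.or b)) (h₁ : Prv L (insert a Γ) θ)
    (h₂ : Prv L (insert b Γ) θ) : Prv L Γ θ := by
  obtain ⟨m, hm⟩ := h₁.exists_safe (Prf.sentence h).1
  obtain ⟨n, hn⟩ := h₂.exists_safe (Prf.sentence h).2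
  exact Prf.unbox (.orElim h (hm _ (le_max_left m n)) (hn _ (le_max_right m n)))

theorem Prv.ex_elim {i : ℕ} (h : Prv L Γ a.ex) (fΓ : FreshIn i Γ) (fa : ¬ a.OccC (Sum.inr i))
    (fθ : ¬ θ.OccC (Sum.inr i)) (h' : Prv L (insert (subst0 a (aconst L i)) Γ) θ) :
    Prv L Γ θ := by
  have s : (subst0 a (aconst L i)).Sentence :=
    Formula.ClosedAt.subst0 (Prf.sentence h) (aconst_closed i)
  obtain ⟨n, hn⟩ := h'.exists_safe s
  exact Prf.unbox (.exElim subset_rfl subset_rfl fΓ (fun _ h => absurd h (Set.notMem_empty _))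
    fa (mt boxN_occC.1 fθ) h (hn n le_rfl))

theorem Prv.or_all {i : ℕ} (fΓ : FreshIn i Γ) (fa : ¬ a.OccC (Sum.inr i))
    (fb : ¬ b.OccC (Sum.inr i)) (h : Prv L Γ (a.or (subst0 b (aconst L i)))) :
    Prv L Γ (a.or b.all) := by
  have sa : a.Sentence := (Prf.sentence h).1
  refine .cd sa (.allIntro subset_rfl subset_rfl fΓ (fun _ h => absurd h (Set.notMem_empty _))
    (fun h => h.elim fa fb) (i := i) ?_)
  have eq : subst0 (a.or b) (aconst L i) = a.or (subst0 b (aconst L i)) :=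
    congrArg (fun x => Formula.or x _) (sa.subst0_eq _)
  rw [eq]
  exact h

end Derivations

section Extension

variable {L : Signature} {Γ : Set (Formula L.plus)} {χ ψ : Formula L.plus}

/-- A stage of the extension process: a set `Γ` of sentences omitting infinitely many fresh
constants, together with a sentence `χ` not provable from it. -/
structure IsStage (Γ : Set (Formula L.plus)) (χ : Formula L.plus) : Prop where
  sentence : ∀ ψ ∈ Γ, Formula.Sentence ψ
  infinite : {i : ℕ | FreshIn i Γ}.Infinite
  target : χ.Sentence
  not_prv : ¬ Prv L Γ χ

theorem infinite_fresh_insert (h : {i : ℕ | FreshIn i Γ}.Infinite) (ψ : Formula L.plus) :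
    {i : ℕ | FreshIn i (insert ψ Γ)}.Infinite := by
  refine (h.sdiff ψ.finite_occC).mono ?_
  rintro i ⟨hi, hψ⟩ _ (rfl | hm)
  · exact hψ
  · exact hi _ hm

theorem IsStage.insert_sentence (h : IsStage Γ χ) (hψ : ψ.Sentence) (hn : ¬ Prv L (insert ψ Γ) χ) :
    IsStage (insert ψ Γ) χ where
  sentence := by
    rintro _ (rfl | hm)
    · exact hψ
    · exact h.sentence _ hm
  infinite := infinite_fresh_insert h.infinite ψ
  target := h.target
  not_prv := hn

theorem IsStage.exists_fresh (h : IsStage Γ χ) (ψ : Formula L.plus) :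
    ∃ i, FreshIn i Γ ∧ ¬ ψ.OccC (Sum.inr i) ∧ ¬ χ.OccC (Sum.inr i) := by
  obtain ⟨i, hi⟩ := (infinite_fresh_insert (infinite_fresh_insert h.infinite ψ) χ).nonempty
  exact ⟨i, fun _ hm => hi _ (.inr (.inr hm)), hi _ (.inr (.inl rfl)), hi _ (.inl rfl)⟩

/-- What the next stage `(Γ', χ')` achieves for the sentence `ψ`. -/
structure IsStep (Γ : Set (Formula L.plus)) (χ ψ : Formula L.plus) (Γ' : Set (Formula L.plus))
    (χ' : Formula L.plus) : Prop where
  subset : Γ ⊆ Γ'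
  target : ∀ S, Prv L S χ → Prv L S χ'
  decides : ψ ∈ Γ' ∨ Prv L (insert ψ Γ) χ
  witness : ∀ θ, ψ = .ex θ → Prv L (insert ψ Γ) χ ∨
    ∃ t : Term L.plus, t.Closed ∧ subst0 θ t ∈ Γ'
  counterexample : ∀ θ, ψ = .all θ → ψ ∈ Γ' ∨
    ∃ t : Term L.plus, t.Closed ∧ ∀ S, Prv L S (subst0 θ t) → Prv L S χ'

theorem IsStage.exists_step (h : IsStage Γ χ) (hψ : ψ.Sentence) :
    ∃ Γ' χ', IsStage Γ' χ' ∧ IsStep Γ χ ψ Γ' χ' := by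
  by_cases hp : Prv L (insert ψ Γ) χ
  · by_cases hall : ∃ θ, ψ = .all θ
    · obtain ⟨θ, rfl⟩ := hall
      obtain ⟨i, fΓ, fθ, fχ⟩ := h.exists_fresh θ
      have st : (subst0 θ (aconst L i)).Sentence :=
        Formula.ClosedAt.subst0 hψ (aconst_closed i)
      refine ⟨Γ, χ.or (subst0 θ (aconst L i)),
        ⟨h.sentence, h.infinite, ⟨h.target, st⟩, fun hor => h.not_prv ?_⟩,
        subset_rfl, fun S hS => .orIntroL st hS, .inr hp, fun _ _ => .inl hp, ?_⟩
      · refine (Prv.or_all fΓ fχ fθ hor).or_elim ?_ hp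
        exact Prf.hyp (by simp) h.target
      · rintro _ ⟨⟩
        exact .inr ⟨aconst L i, aconst_closed i, fun S hS => .orIntroR h.target hS⟩
    · exact ⟨Γ, χ, h, subset_rfl, fun _ => id, .inr hp, fun _ _ => .inl hp,
        fun θ hθ => absurd ⟨θ, hθ⟩ hall⟩
  · have h₁ := h.insert_sentence hψ hp
    by_cases hex : ∃ θ, ψ = .ex θ
    · obtain ⟨θ, rfl⟩ := hex
      obtain ⟨i, fΓ, fθ, fχ⟩ := h₁.exists_fresh θ
      have st : (subst0 θ (aconst L i)).Sentence :=
        Formula.ClosedAt.subst0 hψ (aconst_closed i)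
      refine ⟨_, χ, h₁.insert_sentence st fun hst => h₁.not_prv ?_,
        (Set.subset_insert _ _).trans (Set.subset_insert _ _), fun _ => id,
        .inl (by simp), ?_, fun _ _ => .inl (by simp)⟩
      · exact Prv.ex_elim (Prf.hyp (by simp) hψ) fΓ fθ fχ hst
      · rintro _ ⟨⟩
        exact .inr ⟨aconst L i, aconst_closed i, by simp⟩
    · exact ⟨_, χ, h₁, Set.subset_insert _ _, fun _ => id, .inl (by simp),
        fun θ hθ => absurd ⟨θ, hθ⟩ hex, fun _ _ => .inl (by simp)⟩

theorem IsStage.exists_sequence (h : IsStage Γ χ) (e : ℕ → Formula L.plus) :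
    ∃ (G : ℕ → Set (Formula L.plus)) (X : ℕ → Formula L.plus), G 0 = Γ ∧ X 0 = χ ∧
      (∀ n, IsStage (G n) (X n)) ∧
      (∀ n, G n ⊆ G (n + 1)) ∧ (∀ n S, Prv L S (X n) → Prv L S (X (n + 1))) ∧
      ∀ n, (e n).Sentence → IsStep (G n) (X n) (e n) (G (n + 1)) (X (n + 1)) := by
  have step : ∀ (n : ℕ) (s : {s : Set (Formula L.plus) × Formula L.plus // IsStage s.1 s.2}),
      ∃ s' : {s : Set (Formula L.plus) × Formula L.plus // IsStage s.1 s.2},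
        s.1.1 ⊆ s'.1.1 ∧ (∀ S, Prv L S s.1.2 → Prv L S s'.1.2) ∧
        ((e n).Sentence → IsStep s.1.1 s.1.2 (e n) s'.1.1 s'.1.2) := by
    intro n s
    by_cases hs : (e n).Sentence
    · obtain ⟨Γ', χ', h', hstep⟩ := s.2.exists_step hs
      exact ⟨⟨(Γ', χ'), h'⟩, hstep.subset, hstep.target, fun _ => hstep⟩
    · exact ⟨s, subset_rfl, fun _ => id, fun h => absurd h hs⟩
  choose f hf using step
  let s : ℕ → {s : Set (Formula L.plus) × Formula L.plus // IsStage s.1 s.2} :=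
    fun n => Nat.rec ⟨(Γ, χ), h⟩ f n
  exact ⟨fun n => (s n).1.1, fun n => (s n).1.2, rfl, rfl, fun n => (s n).2,
    fun n => (hf n (s n)).1, fun n => (hf n (s n)).2.1, fun n => (hf n (s n)).2.2⟩

end Extension


/-- **Extension** (Lemma 13 of §5.2): for `Γ` omitting infinitely many of the fresh
constants `aᵢ` (over a countable language): if `Γ ⊬ φ` then there exists `Γ' ⊇ Γ`
such that `Γ'` is a prime saturated `BQL_CD^r`-theory and `φ ∉ Γ'`. -/
theorem extension_lemma {L : Signature}
    [Countable L.Const] [Countable L.Func] [Countable L.Rel]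
    (Γ : Set (Formula L.plus)) (hΓ : ∀ ψ ∈ Γ, Formula.Sentence ψ)
    (hinf : {i : ℕ | ∀ ψ ∈ Γ, ¬ Formula.OccC (Sum.inr i) ψ}.Infinite)
    (φ : Formula L.plus) (hφ : φ.Sentence) (h : ¬ Prv L Γ φ) :
    ∃ Γ' : Set (Formula L.plus), Γ ⊆ Γ' ∧ PSTr L Γ' ∧ φ ∉ Γ' := by
  have := (inferInstance : Countable (L.Const ⊕ ℕ))
  have : Countable L.plus.Const := this
  have : Countable L.plus.Func := ‹Countable L.Func›
  have : Countable L.plus.Rel := ‹Countable L.Rel›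
  have := Formula.countable (L := L.plus)
  have : Nonempty (Formula L.plus) := ⟨.top⟩
  obtain ⟨e, he⟩ := exists_surjective_nat (Formula L.plus)
  obtain ⟨G, X, hG₀, hX₀, hstage, hGsucc, hXsucc, hstep⟩ :=
    IsStage.exists_sequence ⟨hΓ, hinf, hφ, h⟩ e
  have hG : Monotone G := monotone_nat_of_le_succ hGsucc
  have hX : ∀ {m n}, m ≤ n → ∀ S, Prv L S (X m) → Prv L S (X n) := by
    intro m n hmn
    induction hmn with
    | refl => exact fun _ => id
    | step _ ih => exact fun S hS => hXsucc _ S (ih S hS)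
  have sub : ∀ n, G n ⊆ ⋃ n, G n := Set.subset_iUnion G
  have sentence : ∀ ψ ∈ ⋃ n, G n, Formula.Sentence ψ := fun ψ hψ =>
    let ⟨n, hn⟩ := Set.mem_iUnion.1 hψ
    (hstage n).sentence ψ hn
  have unprovable : ∀ n, ¬ Prv L (⋃ n, G n) (X n) := by
    intro n hn
    obtain ⟨γ, k, hγ, hn⟩ := hn.exists_conj
    obtain ⟨m, hm⟩ := hγ.exists_of_iUnion hG
    exact (hstage (max m n)).not_prv
      (hX (le_max_right m n) _ (Prf.unbox ((hm.mono (hG (le_max_left m n))).prf.cut hn)))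
  have refute : ∀ ψ : Formula L.plus, ψ.Sentence → ψ ∉ ⋃ n, G n →
      ∃ n, Prv L (insert ψ (⋃ n, G n)) (X n) := by
    intro ψ hψ hn
    obtain ⟨n, rfl⟩ := he ψ
    exact ⟨n, ((hstep n hψ).decides.resolve_left fun hm => hn (sub _ hm)).mono
      (Set.insert_subset_insert (sub n))⟩
  have closed : ∀ ψ : Formula L.plus, Prv L (⋃ n, G n) ψ → ψ ∈ ⋃ n, G n := by
    intro ψ hp
    by_contra hn
    obtain ⟨n, hn⟩ := refute ψ (Prf.sentence hp) hn
    exact unprovable n (hp.cut hn)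
  have mem : ∀ {ψ}, ψ ∈ ⋃ n, G n → Prv L (⋃ n, G n) ψ := fun hm =>
    Prf.hyp (.inl hm) (sentence _ hm)
  refine ⟨⋃ n, G n, hG₀ ▸ sub 0, ⟨sentence, fun hbot => ?_, fun ψ _ => closed ψ, ?_, ?_, ?_⟩,
    fun hm => unprovable 0 (hX₀ ▸ mem hm)⟩
  · exact unprovable 0 (.botElim (hstage 0).target (mem hbot))
  · intro a b hor
    by_contra! hn
    obtain ⟨m, hm⟩ := refute a (sentence _ hor).1 hn.1
    obtain ⟨n, hn⟩ := refute b (sentence _ hor).2 hn.2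
    exact unprovable (max m n) ((mem hor).or_elim (hX (le_max_left m n) _ hm)
      (hX (le_max_right m n) _ hn))
  · intro a hex
    obtain ⟨n, hn⟩ := he (.ex a)
    rcases (hstep n (hn ▸ sentence _ hex)).witness a hn with hp | ⟨t, ht, hm⟩
    · refine absurd (hp.mono (Set.insert_subset ?_ (sub n))) (unprovable n)
      exact hn ▸ hex
    · exact ⟨t, ht, sub _ hm⟩
  · intro a ha hall
    obtain ⟨n, hn⟩ := he (.all a)
    have hs : (e n).Sentence := hn ▸ ha
    rcases (hstep n hs).counterexample a hn with hm | ⟨t, ht, hX'⟩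
    · exact hn ▸ sub _ hm
    · exact absurd (hX' _ (mem (hall t ht))) (unprovable (n + 1))

end BQL
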